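/- Let ω, v ∈ ℝ³ with ω ≠ 0, write θ = ‖ω‖, K = ω̂, V = v̂, and let A be the 6×6 real block matrix [[K, 0], [V, K]]. Then the series ∑_{j=0}^∞ (1/(j+1)!) A^j converges and equals the block matrix [[D, 0], [C, D]], where D = I + ((1 − cos θ)/θ²) K + ((θ − sin θ)/θ³) K², and C = ((2 − 2cos θ − (θ/2) sin θ)/θ²) V + ((θ − sin θ)/θ³)(KV + VK) + ((1 − cos θ − (θ/2) sin θ)/θ⁴)(K²V + KVK + VK²) + ((θ − (3/2) sin θ + (θ/2) cos θ)/θ⁵)(K²VK + KVK²), with I the 3×3 identity matrix. -/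

import Mathlib

open Real

/-- The hat map `∧ : ℝ³ → 𝔰𝔬(3)`. -/
noncomputable def hatSO3 (ω : EuclideanSpace ℝ (Fin 3)) : Matrix (Fin 3) (Fin 3) ℝ :=
  !![0, -ω 2, ω 1; ω 2, 0, -ω 0; -ω 1, ω 0, 0]

theorem hatSO3_pow_three (ω : EuclideanSpace ℝ (Fin 3)) :
    hatSO3 ω ^ 3 = -(‖ω‖ ^ 2) • hatSO3 ω := by
  rw [EuclideanSpace.real_norm_sq_eq, Fin.sum_univ_three]
  ext i j
  fin_cases i <;> fin_cases j <;>
    simp [hatSO3, pow_succ, Matrix.mul_apply, Fin.sum_univ_three] <;> ring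

/-- Since `ω̂² + ‖ω‖² = ω ωᵀ`, the product below is `ω (ωᵀ v̂ ω) ωᵀ = 0`. -/
theorem hatSO3_sq_add_mul_hatSO3_mul (ω v : EuclideanSpace ℝ (Fin 3)) :
    (hatSO3 ω ^ 2 + (‖ω‖ ^ 2) • (1 : Matrix (Fin 3) (Fin 3) ℝ)) * hatSO3 v *
      (hatSO3 ω ^ 2 + (‖ω‖ ^ 2) • (1 : Matrix (Fin 3) (Fin 3) ℝ)) = 0 := by
  have h : hatSO3 ω ^ 2 + (‖ω‖ ^ 2) • (1 : Matrix (Fin 3) (Fin 3) ℝ) =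
      Matrix.of fun i j => ω i * ω j := by
    rw [EuclideanSpace.real_norm_sq_eq, Fin.sum_univ_three]
    ext i j
    fin_cases i <;> fin_cases j <;>
      simp [hatSO3, pow_succ] <;> ring
  rw [h]
  ext i j
  simp [hatSO3, Matrix.mul_apply, Fin.sum_univ_three]
  ring

theorem fromBlocks_pow_two {n R : Type*} [Fintype n] [DecidableEq n] [Ring R] (K V : Matrix n n R) :
    Matrix.fromBlocks K 0 V K ^ 2 =
      Matrix.fromBlocks (K ^ 2) 0 (K * V + V * K) (K ^ 2) := by
  simp [pow_two, Matrix.fromBlocks_multiply, add_comm]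

theorem fromBlocks_pow_three {n R : Type*} [Fintype n] [DecidableEq n] [Ring R]
    (K V : Matrix n n R) :
    Matrix.fromBlocks K 0 V K ^ 3 =
      Matrix.fromBlocks (K ^ 3) 0 (K ^ 2 * V + K * V * K + V * K ^ 2) (K ^ 3) := by
  rw [pow_succ, fromBlocks_pow_two, Matrix.fromBlocks_multiply]
  congr 1 <;> simp [pow_succ]
  noncomm_ring

theorem fromBlocks_pow_four {n R : Type*} [Fintype n] [DecidableEq n] [Ring R]
    (K V : Matrix n n R) :
    Matrix.fromBlocks K 0 V K ^ 4 =
      Matrix.fromBlocks (K ^ 4) 0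
        (K ^ 3 * V + K ^ 2 * V * K + K * V * K ^ 2 + V * K ^ 3) (K ^ 4) := by
  rw [pow_succ, fromBlocks_pow_three, Matrix.fromBlocks_multiply]
  congr 1 <;> simp [pow_succ]
  noncomm_ring

theorem fromBlocks_pow_five {n R : Type*} [Fintype n] [DecidableEq n] [Ring R]
    (K V : Matrix n n R) :
    Matrix.fromBlocks K 0 V K ^ 5 =
      Matrix.fromBlocks (K ^ 5) 0
        (K ^ 4 * V + K ^ 3 * V * K + K ^ 2 * V * K ^ 2 + K * V * K ^ 3 + V * K ^ 4) (K ^ 5) := by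
  rw [pow_succ, fromBlocks_pow_four, Matrix.fromBlocks_multiply]
  congr 1 <;> simp [pow_succ]
  noncomm_ring

/-- The adjoint representation of `𝔰𝔢(3)` is annihilated by `x (x² + ‖ω‖²)²`. -/
theorem fromBlocks_hatSO3_pow_five (ω v : EuclideanSpace ℝ (Fin 3)) :
    Matrix.fromBlocks (hatSO3 ω) 0 (hatSO3 v) (hatSO3 ω) ^ 5 =
      -(2 * ‖ω‖ ^ 2) • Matrix.fromBlocks (hatSO3 ω) 0 (hatSO3 v) (hatSO3 ω) ^ 3 -
        (‖ω‖ ^ 4) • Matrix.fromBlocks (hatSO3 ω) 0 (hatSO3 v) (hatSO3 ω) := by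
  have h3 := hatSO3_pow_three ω
  have hV := hatSO3_sq_add_mul_hatSO3_mul ω v
  generalize hatSO3 ω = K at *
  generalize hatSO3 v = V at *
  have h4 : K ^ 4 = -(‖ω‖ ^ 2) • K ^ 2 := by
    rw [pow_succ, h3, smul_mul_assoc, ← pow_two]
  have h5 : K ^ 5 = (‖ω‖ ^ 4) • K := by
    rw [pow_succ, h4, smul_mul_assoc, ← pow_succ, h3, smul_smul]
    congr 1
    ring
  have hV' : K ^ 2 * V * K ^ 2 =
      -(‖ω‖ ^ 2) • (K ^ 2 * V + V * K ^ 2) - (‖ω‖ ^ 4) • V := by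
    simp only [add_mul, mul_add, smul_mul_assoc, mul_smul_comm, one_mul, mul_one] at hV
    rw [← sub_eq_zero, ← hV]
    module
  rw [fromBlocks_pow_five, fromBlocks_pow_three, sub_eq_add_neg, Matrix.fromBlocks_smul,
    Matrix.fromBlocks_smul, Matrix.fromBlocks_neg, Matrix.fromBlocks_add, h5, h4, h3, hV']
  simp only [smul_mul_assoc, mul_smul_comm, mul_assoc]
  congr 1
  · module
  · simp
  · module
  · module

/-- Odd powers of an element annihilated by `x (x² + t)²`. -/
theorem pow_two_mul_add_one_of_pow_five {R : Type*} [Ring R] [Algebra ℝ R] {a : R} {t : ℝ}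
    (ht : t ≠ 0) (h : a ^ 5 = -(2 * t) • a ^ 3 - (t ^ 2) • a) (n : ℕ) :
    a ^ (2 * n + 1) = ((-t) ^ n * (1 - n)) • a - ((-t) ^ n * n / t) • a ^ 3 := by
  induction n with
  | zero => simp
  | succ n ih =>
    have h3 : a * a ^ 2 = a ^ 3 := by rw [← pow_succ']
    have h5 : a ^ 3 * a ^ 2 = a ^ 5 := by rw [← pow_add]
    rw [show 2 * (n + 1) + 1 = (2 * n + 1) + 2 by ring, pow_add, ih, sub_mul, smul_mul_assoc,
      smul_mul_assoc, h3, h5, h]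
    push_cast
    match_scalars <;> field_simp <;> ring

theorem hasSum_neg_sq_pow_div_factorial_one {θ : ℝ} (hθ : θ ≠ 0) :
    HasSum (fun n : ℕ => (-θ ^ 2) ^ n / (2 * n + 1).factorial) (sin θ / θ) := by
  convert (Real.hasSum_sin θ).div_const θ using 1
  · rfl
  · ext n
    rw [neg_pow, ← pow_mul, pow_succ θ]
    field_simp

theorem hasSum_neg_sq_pow_div_factorial_two {θ : ℝ} (hθ : θ ≠ 0) :
    HasSum (fun n : ℕ => (-θ ^ 2) ^ n / (2 * n + 2).factorial) ((1 - cos θ) / θ ^ 2) := by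
  convert (((hasSum_nat_add_iff' 1).2 (Real.hasSum_cos θ)).div_const (-θ ^ 2)) using 1
  · rfl
  · ext n
    rw [show 2 * (n + 1) = 2 * n + 2 by ring, neg_pow, ← pow_mul, pow_add θ, pow_succ (-1 : ℝ)]
    field_simp
  · simp
    field_simp
    ring

theorem hasSum_neg_sq_pow_div_factorial_three {θ : ℝ} (hθ : θ ≠ 0) :
    HasSum (fun n : ℕ => (-θ ^ 2) ^ n / (2 * n + 3).factorial) ((θ - sin θ) / θ ^ 3) := by
  convert (((hasSum_nat_add_iff' 1).2 (Real.hasSum_sin θ)).div_const (-θ ^ 3)) using 1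
  · rfl
  · ext n
    rw [show 2 * (n + 1) + 1 = 2 * n + 3 by ring, neg_pow, ← pow_mul, pow_add θ,
      pow_succ (-1 : ℝ)]
    field_simp
  · simp
    field_simp
    ring

theorem hasSum_neg_sq_pow_mul_div_factorial_two {θ : ℝ} (hθ : θ ≠ 0) :
    HasSum (fun n : ℕ => (-θ ^ 2) ^ n * n / (2 * n + 2).factorial)
      (sin θ / θ / 2 - (1 - cos θ) / θ ^ 2) := by
  convert ((hasSum_neg_sq_pow_div_factorial_one hθ).div_const 2).sub
    (hasSum_neg_sq_pow_div_factorial_two hθ) using 1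
  · rfl
  · ext n
    rw [Nat.factorial_succ (2 * n + 1)]
    push_cast
    field_simp
    ring

theorem hasSum_neg_sq_pow_mul_div_factorial_three {θ : ℝ} (hθ : θ ≠ 0) :
    HasSum (fun n : ℕ => (-θ ^ 2) ^ n * n / (2 * n + 3).factorial)
      ((1 - cos θ) / θ ^ 2 / 2 - 3 / 2 * ((θ - sin θ) / θ ^ 3)) := by
  convert ((hasSum_neg_sq_pow_div_factorial_two hθ).div_const 2).sub
    ((hasSum_neg_sq_pow_div_factorial_three hθ).mul_left (3 / 2)) using 1
  · rfl
  · ext n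
    rw [Nat.factorial_succ (2 * n + 2)]
    push_cast
    field_simp
    ring

/-- `dexp` as a quartic polynomial, for an element annihilated by `x (x² + θ²)²`. -/
theorem hasSum_inv_factorial_smul_pow_of_pow_five {R : Type*} [Ring R] [Algebra ℝ R]
    [TopologicalSpace R] [IsTopologicalRing R] [ContinuousSMul ℝ R] {a : R} {θ : ℝ}
    (hθ : θ ≠ 0) (h : a ^ 5 = -(2 * θ ^ 2) • a ^ 3 - (θ ^ 4) • a) :
    HasSum (fun j : ℕ => (((j + 1).factorial : ℝ))⁻¹ • a ^ j)
      (1 + ((4 - 4 * cos θ - θ * sin θ) / (2 * θ ^ 2)) • a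
        + ((4 * θ - 5 * sin θ + θ * cos θ) / (2 * θ ^ 3)) • a ^ 2
        + ((2 - 2 * cos θ - θ * sin θ) / (2 * θ ^ 4)) • a ^ 3
        + ((2 * θ - 3 * sin θ + θ * cos θ) / (2 * θ ^ 5)) • a ^ 4) := by
  have hpow := pow_two_mul_add_one_of_pow_five (a := a) (pow_ne_zero 2 hθ)
    (by rw [h, ← pow_mul])
  have c2 := hasSum_neg_sq_pow_div_factorial_two hθ
  have c3 := hasSum_neg_sq_pow_div_factorial_three hθ
  have d2 := hasSum_neg_sq_pow_mul_div_factorial_two hθ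
  have d3 := hasSum_neg_sq_pow_mul_div_factorial_three hθ
  have hodd := ((c2.sub d2).smul_const a).sub ((d2.div_const (θ ^ 2)).smul_const (a ^ 3))
  have heven := ((c3.sub d3).smul_const (a ^ 2)).sub ((d3.div_const (θ ^ 2)).smul_const (a ^ 4))
  rw [← hasSum_nat_add_iff' 1]
  have hodd_eq : ∀ n : ℕ, (((2 * n + 1 + 1).factorial : ℝ))⁻¹ • a ^ (2 * n + 1) =
      ((-θ ^ 2) ^ n / (2 * n + 2).factorial - (-θ ^ 2) ^ n * n / (2 * n + 2).factorial) • a -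
        ((-θ ^ 2) ^ n * n / (2 * n + 2).factorial / θ ^ 2) • a ^ 3 := by
    intro n
    rw [hpow]
    match_scalars <;> field_simp
  have heven_eq : ∀ n : ℕ, (((2 * n + 1 + 1 + 1).factorial : ℝ))⁻¹ • a ^ (2 * n + 1 + 1) =
      ((-θ ^ 2) ^ n / (2 * n + 3).factorial - (-θ ^ 2) ^ n * n / (2 * n + 3).factorial) • a ^ 2 -
        ((-θ ^ 2) ^ n * n / (2 * n + 3).factorial / θ ^ 2) • a ^ 4 := by
    intro n
    rw [pow_succ, hpow, sub_mul, smul_mul_assoc, smul_mul_assoc, ← pow_two, ← pow_succ]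
    match_scalars <;> field_simp
  simp only [← hodd_eq] at hodd
  simp only [← heven_eq] at heven
  convert HasSum.even_add_odd
    (f := fun j : ℕ => (((j + 1 + 1).factorial : ℝ))⁻¹ • a ^ (j + 1)) hodd heven using 1
  · rfl
  simp only [Finset.range_one, Finset.sum_singleton, zero_add, Nat.factorial_one, Nat.cast_one,
    inv_one, pow_zero, one_smul]
  match_scalars <;> field_simp <;> ring

/-- Exact closed form of `dexp` on `SE(3)`: with `A = [[K, 0], [V, K]]` the matrix
representation of `ad_ξ` for `ξ = (ω, v) ∈ 𝔰𝔢(3)` and `ω ≠ 0`, the series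
`∑_{j≥0} A^j/(j+1)!` converges to the block matrix `[[D, 0], [C, D]]`. -/
theorem dexp_se3_closed_form (ω v : EuclideanSpace ℝ (Fin 3)) (hω : ω ≠ 0)
    (θ : ℝ) (hθ : θ = ‖ω‖)
    (K V : Matrix (Fin 3) (Fin 3) ℝ) (hK : K = hatSO3 ω) (hV : V = hatSO3 v)
    (A : Matrix (Fin 3 ⊕ Fin 3) (Fin 3 ⊕ Fin 3) ℝ)
    (hA : A = Matrix.fromBlocks K 0 V K)
    (D C : Matrix (Fin 3) (Fin 3) ℝ)
    (hD : D = 1 + ((1 - cos θ) / θ ^ 2) • K + ((θ - sin θ) / θ ^ 3) • K ^ 2)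
    (hC : C = ((2 - 2 * cos θ - (θ / 2) * sin θ) / θ ^ 2) • V
      + ((θ - sin θ) / θ ^ 3) • (K * V + V * K)
      + ((1 - cos θ - (θ / 2) * sin θ) / θ ^ 4) • (K ^ 2 * V + K * V * K + V * K ^ 2)
      + ((θ - (3 / 2) * sin θ + (θ / 2) * cos θ) / θ ^ 5) •
          (K ^ 2 * V * K + K * V * K ^ 2)) :
    HasSum (fun j : ℕ => (((j + 1).factorial : ℝ))⁻¹ • A ^ j)
      (Matrix.fromBlocks D 0 C D) := by
  have hθ0 : θ ≠ 0 := by rw [hθ]; exact norm_ne_zero_iff.2 hω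
  have h5 := fromBlocks_hatSO3_pow_five ω v
  have h3 := hatSO3_pow_three ω
  rw [← hK, ← hθ] at h3
  rw [← hK, ← hV, ← hθ] at h5
  have h4 : K ^ 4 = -(θ ^ 2) • K ^ 2 := by
    rw [pow_succ, h3, smul_mul_assoc, ← pow_two]
  rw [hA]
  convert hasSum_inv_factorial_smul_pow_of_pow_five hθ0 h5 using 1
  · rfl
  rw [fromBlocks_pow_two, fromBlocks_pow_three, fromBlocks_pow_four, h4, h3, hD, hC,
    ← Matrix.fromBlocks_one]
  simp only [Matrix.fromBlocks_smul, Matrix.fromBlocks_add, smul_mul_assoc, mul_smul_comm]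
  congr 1
  · match_scalars <;> field_simp <;> ring
  · simp
  · match_scalars <;> field_simp <;> ring
  · match_scalars <;> field_simp <;> ring
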